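/- arXiv:2105.04791 — 2 statements merged into one kernel-verified Lean document; each statement's English description precedes it below -/
import Mathlib

section
/- Let n and k be nonnegative integers. For a permutation σ of {1,…,n+k}, written in one-line notation σ_1 σ_2 ⋯ σ_{n+k}, call a position i 'small' if σ_i ≤ n and 'large' if σ_i > n. Say σ is an (n,k)-poly-Cauchy permutation if: (A1) within every maximal run of consecutive positions all of whose entries are large, the entries are increasing; and (A2) calling a small position i a run-maximum if σ_j < σ_i for every position j < i lying in the same maximal run of consecutive small positions as i, the entries at the run-maximum positions, read from left to right across the whole permutation, form an increasing sequence. Then the number of (n,k)-poly-Cauchy permutations equals ĉ_{n,k} = Σ_{m=0}^{n} c(n,m)·(m+1)^k. -/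
/-- Unsigned Stirling numbers of the first kind:
`c(0,0)=1`, `c(n,m)=0` for `m>n` or (`n>0` and `m=0`), and `c(n+1,m)=n*c(n,m)+c(n,m-1)`. -/
def stirling1 : ℕ → ℕ → ℕ
  | 0, 0 => 1
  | 0, _ + 1 => 0
  | _ + 1, 0 => 0
  | n + 1, m + 1 => n * stirling1 n (m + 1) + stirling1 n m

/-- Stirling numbers of the second kind:
`S(0,0)=1`, `S(n,m)=0` for `m>n` or (`n>0` and `m=0`), and `S(n+1,m)=m*S(n,m)+S(n,m-1)`. -/
def stirling2 : ℕ → ℕ → ℕ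
  | 0, 0 => 1
  | 0, _ + 1 => 0
  | _ + 1, 0 => 0
  | n + 1, m + 1 => (m + 1) * stirling2 n (m + 1) + stirling2 n m

/-- Poly-Cauchy numbers of the second kind (negated upper index, unsigned):
`ĉ_{n,k} = Σ_{m=0}^n c(n,m)·(m+1)^k`. -/
def polyCauchy (n k : ℕ) : ℕ := ∑ m ∈ Finset.range (n + 1), stirling1 n m * (m + 1) ^ k

/-- Position `i` is *small* for `σ` if its entry is one of the `n` smallest values
(i.e. `σ i ≤ n` in 1-based terms, `(σ i : ℕ) < n` in 0-based terms). -/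
def IsSmall {N : ℕ} (n : ℕ) (σ : Equiv.Perm (Fin N)) (i : Fin N) : Prop :=
  (σ i : ℕ) < n

/-- A small position `i` is a *run-maximum* if its entry exceeds the entries of all
earlier positions lying in the same maximal run of consecutive small positions. -/
def IsRunMax {N : ℕ} (n : ℕ) (σ : Equiv.Perm (Fin N)) (i : Fin N) : Prop :=
  IsSmall n σ i ∧
    ∀ j : Fin N, j < i → (∀ p : Fin N, j ≤ p → p ≤ i → IsSmall n σ p) → σ j < σ i

/-- An `(n,k)`-poly-Cauchy permutation: a permutation of `n + k` letters such that
(A1) entries in every maximal run of consecutive large positions increase, and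
(A2) the entries at run-maximum positions of the maximal runs of small positions
increase from left to right across the whole permutation. -/
def IsPolyCauchyPerm (n k : ℕ) (σ : Equiv.Perm (Fin (n + k))) : Prop :=
  (∀ i : Fin (n + k), ∀ h : (i : ℕ) + 1 < n + k,
      n ≤ (σ i : ℕ) → n ≤ (σ ⟨(i : ℕ) + 1, h⟩ : ℕ) → σ i < σ ⟨(i : ℕ) + 1, h⟩) ∧
  (∀ i j : Fin (n + k), IsRunMax n σ i → IsRunMax n σ j → i < j → σ i < σ j)

open Finset

section Records

variable {n : ℕ} {α : Type*} [LinearOrder α]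

/-- If `u` sends each letter to its position in a word, then `c` is a *record*
(left-to-right maximum) when every letter to the left of `c` is smaller than `c`. -/
def IsRecord (u : Fin n → α) (c : Fin n) : Prop :=
  ∀ d, u d < u c → d < c

open scoped Classical in
/-- The number of records of the word with position function `u`. -/
noncomputable def numRecords (u : Fin n → α) : ℕ :=
  #{d | IsRecord u d}

open scoped Classical in
/-- The number of records weakly to the left of the letter `c`. -/
noncomputable def recordRank (u : Fin n → α) (c : Fin n) : ℕ :=
  #{d | IsRecord u d ∧ u d ≤ u c}

theorem recordRank_mono (u : Fin n → α) {c d : Fin n} (h : u c ≤ u d) :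
    recordRank u c ≤ recordRank u d := by
  classical
  unfold recordRank
  refine card_le_card fun e he => ?_
  simp only [mem_filter, mem_univ, true_and] at he ⊢
  exact ⟨he.1, he.2.trans h⟩

theorem recordRank_lt (u : Fin n → α) {c d : Fin n} (hd : IsRecord u d) (h : u c < u d) :
    recordRank u c < recordRank u d := by
  classical
  unfold recordRank
  refine card_lt_card ((ssubset_iff_of_subset fun e he => ?_).2 ⟨d, ?_, ?_⟩)
  · simp only [mem_filter, mem_univ, true_and] at he ⊢
    exact ⟨he.1, he.2.trans h.le⟩
  · simp [hd]
  · simp [h]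

theorem recordRank_le_numRecords (u : Fin n → α) (c : Fin n) :
    recordRank u c ≤ numRecords u := by
  classical
  unfold recordRank numRecords
  refine card_le_card fun e he => ?_
  simp only [mem_filter, mem_univ, true_and] at he ⊢
  exact he.1

theorem recordRank_pos (u : Fin n → α) {c : Fin n} (hc : IsRecord u c) :
    0 < recordRank u c := by
  classical
  exact card_pos.2 ⟨c, by simp [hc]⟩

/-- The largest letter weakly to the left of `c` is the last record weakly to the left of `c`. -/
theorem exists_isRecord_recordRank_eq (u : Fin n → α) (c : Fin n) :
    ∃ e, IsRecord u e ∧ u e ≤ u c ∧ c ≤ e ∧ recordRank u e = recordRank u c := by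
  classical
  obtain ⟨e, he, hmax⟩ := exists_max_image ({d | u d ≤ u c} : Finset (Fin n)) id ⟨c, by simp⟩
  simp only [mem_filter, mem_univ, true_and, id] at he hmax
  have hrec : IsRecord u e := fun d hd =>
    lt_of_le_of_ne (hmax d (hd.le.trans he)) (by rintro rfl; exact hd.false)
  refine ⟨e, hrec, he, hmax c le_rfl, le_antisymm (recordRank_mono u he) ?_⟩
  unfold recordRank
  refine card_le_card fun d hd => ?_
  simp only [mem_filter, mem_univ, true_and] at hd ⊢
  refine ⟨hd.1, ?_⟩
  by_contra! hlt
  exact absurd (hd.1 e hlt) (not_lt.2 (hmax d hd.2))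

theorem exists_isRecord_recordRank_eq_succ {u : Fin n → α} (hu : Function.Injective u) {t : ℕ}
    (ht : t < numRecords u) : ∃ d, IsRecord u d ∧ recordRank u d = t + 1 := by
  classical
  have hinj : Set.InjOn (recordRank u) ({d | IsRecord u d} : Finset (Fin n)) := by
    intro a ha b hb hab
    simp only [coe_filter, mem_univ, true_and, Set.mem_ofPred_eq] at ha hb
    rcases lt_trichotomy (u a) (u b) with h | h | h
    · exact absurd hab (recordRank_lt u hb h).ne
    · exact hu h
    · exact absurd hab (recordRank_lt u ha h).ne'
  have hsurj := surjOn_of_injOn_of_card_le (s := ({d | IsRecord u d} : Finset (Fin n)))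
    (t := Icc 1 (numRecords u)) (recordRank u) (fun d hd => by
      simp only [coe_filter, mem_univ, true_and, Set.mem_ofPred_eq] at hd
      simpa using ⟨recordRank_pos u hd, recordRank_le_numRecords u d⟩) hinj
    (by simp [numRecords])
  obtain ⟨d, hd, hdt⟩ := hsurj (show t + 1 ∈ (Icc 1 (numRecords u) : Set ℕ) by simp; omega)
  exact ⟨d, by simpa using hd, hdt⟩

theorem isRecord_congr {β : Type*} [LinearOrder β] {u : Fin n → α} {v : Fin n → β}
    (h : ∀ c d, u c < u d ↔ v c < v d) (c : Fin n) : IsRecord u c ↔ IsRecord v c := by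
  simp only [IsRecord, h]

end Records

section StirlingCount

/-- Insert a new smallest letter at position `p` in the word with position function `τ`. -/
def insertMin {n : ℕ} (p : Fin (n + 1)) (τ : Equiv.Perm (Fin n)) : Equiv.Perm (Fin (n + 1)) :=
  ((finSuccEquiv' 0).trans τ.optionCongr).trans (finSuccEquiv' p).symm

theorem insertMin_zero {n : ℕ} (p : Fin (n + 1)) (τ : Equiv.Perm (Fin n)) :
    insertMin p τ 0 = p := by
  simp [insertMin]

theorem insertMin_succ {n : ℕ} (p : Fin (n + 1)) (τ : Equiv.Perm (Fin n)) (i : Fin n) :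
    insertMin p τ i.succ = p.succAbove (τ i) := by
  rw [← Fin.succAbove_zero]
  simp only [insertMin, Equiv.trans_apply, finSuccEquiv'_succAbove]
  simp

theorem insertMin_bijective (n : ℕ) :
    Function.Bijective fun x : Fin (n + 1) × Equiv.Perm (Fin n) => insertMin x.1 x.2 := by
  rw [Fintype.bijective_iff_injective_and_card]
  refine ⟨?_, by simp [Fintype.card_perm, Nat.factorial_succ]⟩
  rintro ⟨p, τ⟩ ⟨q, ρ⟩ h
  have h0 : p = q := by simpa [insertMin_zero] using congrArg (fun e => e 0) h
  subst h0
  simp only [Prod.mk.injEq, true_and]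
  ext1 i
  simpa [insertMin_succ] using congrArg (fun e => e i.succ) h

theorem isRecord_insertMin_zero {n : ℕ} (p : Fin (n + 1)) (τ : Equiv.Perm (Fin n)) :
    IsRecord (insertMin p τ) 0 ↔ p = 0 := by
  constructor
  · intro h
    by_contra hp
    have := h ((insertMin p τ).symm 0) (by
      rw [Equiv.apply_symm_apply, insertMin_zero]; exact Fin.pos_of_ne_zero hp)
    exact absurd this (Fin.not_lt_zero _)
  · rintro rfl d hd
    rw [insertMin_zero] at hd
    exact absurd hd (Fin.not_lt_zero _)

theorem isRecord_insertMin_succ {n : ℕ} (p : Fin (n + 1)) (τ : Equiv.Perm (Fin n)) (i : Fin n) :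
    IsRecord (insertMin p τ) i.succ ↔ IsRecord τ i := by
  simp only [IsRecord, Fin.forall_fin_succ, insertMin_succ, Fin.succ_lt_succ_iff, Fin.succ_pos,
    implies_true, true_and, Fin.succAbove_lt_succAbove_iff]

theorem numRecords_insertMin {n : ℕ} (p : Fin (n + 1)) (τ : Equiv.Perm (Fin n)) :
    numRecords (insertMin p τ) = (if p = 0 then 1 else 0) + numRecords τ := by
  classical
  unfold numRecords
  rw [Fin.card_filter_univ_succ]
  simp only [isRecord_insertMin_zero, isRecord_insertMin_succ]
  split_ifs <;> omega

theorem stirling1_eq_zero_of_lt {n m : ℕ} (h : n < m) : stirling1 n m = 0 := by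
  induction n generalizing m with
  | zero => cases m with
    | zero => omega
    | succ m => rfl
  | succ n ih => cases m with
    | zero => omega
    | succ m => simp [stirling1, ih (show n < m + 1 by omega), ih (show n < m by omega)]

/-- The number of permutations of `n` letters with `m` records is `stirling1 n m`, in the form of
a summation formula for functions of the number of records. -/
theorem sum_numRecords (n : ℕ) (g : ℕ → ℕ) :
    ∑ τ : Equiv.Perm (Fin n), g (numRecords τ) = ∑ m ∈ range (n + 1), stirling1 n m * g m := by
  induction n generalizing g with
  | zero => simp [numRecords, stirling1]
  | succ n ih =>
    have hstep : ∑ τ : Equiv.Perm (Fin (n + 1)), g (numRecords τ)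
        = ∑ τ : Equiv.Perm (Fin n), (g (1 + numRecords τ) + n * g (numRecords τ)) := by
      rw [← (insertMin_bijective n).sum_comp (fun τ => g (numRecords τ)),
        Fintype.sum_prod_type, sum_comm]
      refine sum_congr rfl fun τ _ => ?_
      simp [numRecords_insertMin, Fin.sum_univ_succ, Fin.succ_ne_zero]
    rw [hstep, ih (fun m => g (1 + m) + n * g m), sum_range_succ' _ (n + 1)]
    have hshift : ∑ m ∈ range (n + 1), n * (stirling1 n (m + 1) * g (m + 1))
        + n * (stirling1 n 0 * g 0) = ∑ m ∈ range (n + 1), n * (stirling1 n m * g m) := by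
      rw [← sum_range_succ' (fun m => n * (stirling1 n m * g m)), sum_range_succ,
        stirling1_eq_zero_of_lt (Nat.lt_succ_self n)]
      simp
    have hzero : n * (stirling1 n 0 * g 0) = 0 := by cases n <;> simp [stirling1]
    rw [hzero, add_zero] at hshift
    have hright : ∀ m, stirling1 (n + 1) (m + 1) * g (m + 1)
        = stirling1 n m * g (1 + m) + n * (stirling1 n (m + 1) * g (m + 1)) := by
      intro m
      rw [stirling1, add_comm 1 m]
      ring
    simp only [hright, sum_add_distrib, hshift, mul_add]
    simp only [stirling1, zero_mul, add_zero]
    congr 1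
    exact sum_congr rfl fun m _ => by ring

end StirlingCount

section Rank

theorem exists_equiv_fin_lt_iff {α L : Type*} [Fintype α] [LinearOrder L] {N : ℕ}
    (h : Fintype.card α = N) {κ : α → L} (hκ : Function.Injective κ) :
    ∃ e : α ≃ Fin N, ∀ a b, e a < e b ↔ κ a < κ b := by
  let := LinearOrder.lift' κ hκ
  exact ⟨(Fintype.orderIsoFinOfCardEq α h).symm.toEquiv, fun a b =>
    (Fintype.orderIsoFinOfCardEq α h).symm.lt_iff_lt⟩

theorem equiv_fin_ext_of_lt_iff {α : Type*} {N : ℕ} {e e' : α ≃ Fin N}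
    (h : ∀ a b, e a < e b ↔ e' a < e' b) : e = e' := by
  have hmono : StrictMono fun i => e' (e.symm i) := fun i j hij => by
    rw [← h]; simpa using hij
  let o : Fin N ≃o Fin N := StrictMono.orderIsoOfSurjective _ hmono
    (e'.surjective.comp e.symm.surjective)
  ext1 a
  have : o (e a) = e a := by rw [Subsingleton.elim o (OrderIso.refl _)]; rfl
  rw [← this]
  simp [o]

end Rank

section Encoding

variable {n k : ℕ}

/-- The position of the `c`-th small letter. -/
def smallPos (σ : Equiv.Perm (Fin (n + k))) (c : Fin n) : Fin (n + k) := σ.symm (Fin.castAdd k c)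

/-- The position of the `b`-th large letter. -/
def largePos (σ : Equiv.Perm (Fin (n + k))) (b : Fin k) : Fin (n + k) := σ.symm (Fin.natAdd n b)

@[simp] theorem apply_smallPos (σ : Equiv.Perm (Fin (n + k))) (c : Fin n) :
    σ (smallPos σ c) = Fin.castAdd k c := σ.apply_symm_apply _

@[simp] theorem apply_largePos (σ : Equiv.Perm (Fin (n + k))) (b : Fin k) :
    σ (largePos σ b) = Fin.natAdd n b := σ.apply_symm_apply _

theorem smallPos_injective (σ : Equiv.Perm (Fin (n + k))) : Function.Injective (smallPos σ) :=
  σ.symm.injective.comp (Fin.castAdd_injective n k)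

theorem smallPos_ne_largePos (σ : Equiv.Perm (Fin (n + k))) (c : Fin n) (b : Fin k) :
    smallPos σ c ≠ largePos σ b := by
  intro h
  have := congrArg (fun i => ((σ i : Fin (n + k)) : ℕ)) h
  simp at this
  omega

theorem isSmall_smallPos (σ : Equiv.Perm (Fin (n + k))) (c : Fin n) :
    IsSmall n σ (smallPos σ c) := by
  simp [IsSmall]

theorem not_isSmall_largePos (σ : Equiv.Perm (Fin (n + k))) (b : Fin k) :
    ¬ IsSmall n σ (largePos σ b) := by
  simp [IsSmall]

theorem exists_smallPos_eq {σ : Equiv.Perm (Fin (n + k))} {i : Fin (n + k)} (h : IsSmall n σ i) :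
    ∃ c, smallPos σ c = i :=
  ⟨⟨σ i, h⟩, σ.symm_apply_eq.2 rfl⟩

theorem exists_largePos_eq {σ : Equiv.Perm (Fin (n + k))} {i : Fin (n + k)}
    (h : ¬ IsSmall n σ i) : ∃ b, largePos σ b = i := by
  unfold IsSmall at h
  refine ⟨⟨σ i - n, by omega⟩, σ.symm_apply_eq.2 (Fin.ext ?_)⟩
  simp
  omega

/-- The word `σ` has its small letters in the order of `π`, and is obtained by putting each large
letter `b` right before record number `f b` (counting from zero) of `π`, or at the end, large
letters in the same place being sorted. -/
structure IsEncodedBy (σ : Equiv.Perm (Fin (n + k))) (π : Equiv.Perm (Fin n))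
    (f : Fin k → ℕ) : Prop where
  small_lt_small : ∀ c d, smallPos σ c < smallPos σ d ↔ π c < π d
  large_lt_small : ∀ b c, largePos σ b < smallPos σ c ↔ f b < recordRank π c
  large_lt_large : ∀ b b', largePos σ b < largePos σ b' ↔ f b < f b' ∨ f b = f b' ∧ b < b'

theorem IsEncodedBy.small_lt_large {σ : Equiv.Perm (Fin (n + k))} {π : Equiv.Perm (Fin n)}
    {f : Fin k → ℕ} (h : IsEncodedBy σ π f) (c : Fin n) (b : Fin k) :
    smallPos σ c < largePos σ b ↔ recordRank π c ≤ f b := by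
  rw [← not_lt, ← h.large_lt_small, not_lt]
  exact ⟨le_of_lt, fun hle => lt_of_le_of_ne hle (smallPos_ne_largePos σ c b)⟩

theorem exists_isEncodedBy (π : Equiv.Perm (Fin n)) (f : Fin k → ℕ) :
    ∃ σ : Equiv.Perm (Fin (n + k)), IsEncodedBy σ π f := by
  let κ : Fin (n + k) → ℕ ×ₗ ℕ := Fin.addCases (fun c => toLex (recordRank π c, (π c : ℕ)))
    (fun b => toLex (f b, n + b))
  have hκs : ∀ c, κ (Fin.castAdd k c) = toLex (recordRank π c, (π c : ℕ)) := fun c => by simp [κ]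
  have hκl : ∀ b, κ (Fin.natAdd n b) = toLex (f b, n + (b : ℕ)) := fun b => by simp [κ]
  have hκ : Function.Injective κ := by
    intro x y
    refine Fin.addCases (fun c => ?_) (fun b => ?_) x <;>
      refine Fin.addCases (fun d => ?_) (fun b' => ?_) y <;>
      simp only [hκs, hκl, toLex_inj, Prod.mk.injEq, Fin.val_inj, π.injective.eq_iff]
    · rintro ⟨-, rfl⟩; rfl
    · rintro ⟨-, h⟩; omega
    · rintro ⟨-, h⟩; omega
    · rintro ⟨-, h⟩
      have : b = b' := Fin.ext (by omega)
      rw [this]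
  obtain ⟨e, he⟩ := exists_equiv_fin_lt_iff (Fintype.card_fin _) hκ
  refine ⟨e.symm, ⟨fun c d => ?_, fun b c => ?_, fun b b' => ?_⟩⟩ <;>
    simp only [smallPos, largePos, Equiv.symm_symm, he, hκs, hκl, Prod.Lex.toLex_lt_toLex]
  · constructor
    · rintro (h | h)
      · by_contra! hle
        exact absurd h (not_lt.2 (recordRank_mono π hle))
      · exact h.2
    · intro h
      rcases (recordRank_mono π h.le).lt_or_eq with h' | h'
      · exact Or.inl h'
      · exact Or.inr ⟨h', h⟩
  · omega
  · simp

theorem IsEncodedBy.perm_unique {σ σ' : Equiv.Perm (Fin (n + k))} {π : Equiv.Perm (Fin n)}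
    {f : Fin k → ℕ} (h : IsEncodedBy σ π f) (h' : IsEncodedBy σ' π f) : σ = σ' := by
  refine Equiv.symm_bijective.injective (equiv_fin_ext_of_lt_iff fun x y => ?_)
  refine Fin.addCases (fun c => ?_) (fun b => ?_) x <;>
    refine Fin.addCases (fun d => ?_) (fun b' => ?_) y
  · exact (h.small_lt_small c d).trans (h'.small_lt_small c d).symm
  · exact (h.small_lt_large c b').trans (h'.small_lt_large c b').symm
  · exact (h.large_lt_small b d).trans (h'.large_lt_small b d).symm
  · exact (h.large_lt_large b b').trans (h'.large_lt_large b b').symm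

theorem IsEncodedBy.code_unique {σ : Equiv.Perm (Fin (n + k))} {π π' : Equiv.Perm (Fin n)}
    {f f' : Fin k → ℕ} (h : IsEncodedBy σ π f) (h' : IsEncodedBy σ π' f')
    (hf : ∀ b, f b ≤ numRecords π) (hf' : ∀ b, f' b ≤ numRecords π') : π = π' ∧ f = f' := by
  obtain rfl : π = π' := equiv_fin_ext_of_lt_iff fun c d =>
    (h.small_lt_small c d).symm.trans (h'.small_lt_small c d)
  refine ⟨rfl, funext fun b => ?_⟩
  have key : ∀ c, f b < recordRank π c ↔ f' b < recordRank π c := fun c =>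
    (h.large_lt_small b c).symm.trans (h'.large_lt_small b c)
  rcases lt_trichotomy (f b) (f' b) with hlt | heq | hlt
  · obtain ⟨d, -, hd⟩ := exists_isRecord_recordRank_eq_succ π.injective (hlt.trans_le (hf' b))
    have := key d
    omega
  · exact heq
  · obtain ⟨d, -, hd⟩ := exists_isRecord_recordRank_eq_succ π.injective (hlt.trans_le (hf b))
    have := key d
    omega

theorem IsEncodedBy.isRecord_of_isRunMax {σ : Equiv.Perm (Fin (n + k))} {π : Equiv.Perm (Fin n)}
    {f : Fin k → ℕ} (h : IsEncodedBy σ π f) {c : Fin n} (hc : IsRunMax n σ (smallPos σ c)) :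
    IsRecord π c := by
  obtain ⟨e, he, hec, hle, hrank⟩ := exists_isRecord_recordRank_eq π c
  obtain rfl | hne := eq_or_ne e c
  · exact he
  have hlt : smallPos σ e < smallPos σ c :=
    (h.small_lt_small e c).2 (lt_of_le_of_ne hec (π.injective.ne hne))
  have hval := hc.2 _ hlt fun p hp hp' => by
    by_contra hlarge
    obtain ⟨b, rfl⟩ := exists_largePos_eq hlarge
    have h₁ := (h.small_lt_large e b).1 (lt_of_le_of_ne hp (smallPos_ne_largePos σ e b))
    have h₂ := (h.large_lt_small b c).1 (lt_of_le_of_ne hp' (smallPos_ne_largePos σ c b).symm)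
    omega
  rw [apply_smallPos, apply_smallPos, Fin.lt_def] at hval
  exact absurd (show e < c from hval) (not_lt.2 hle)

theorem IsEncodedBy.isPolyCauchyPerm {σ : Equiv.Perm (Fin (n + k))} {π : Equiv.Perm (Fin n)}
    {f : Fin k → ℕ} (h : IsEncodedBy σ π f) (hf : ∀ b, f b ≤ numRecords π) :
    IsPolyCauchyPerm n k σ := by
  constructor
  · intro i hi h₁ h₂
    obtain ⟨b, hb⟩ := exists_largePos_eq (σ := σ) (i := i) (not_lt.2 h₁)
    obtain ⟨b', hb'⟩ := exists_largePos_eq (σ := σ) (i := ⟨i + 1, hi⟩) (not_lt.2 h₂)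
    have hlt : largePos σ b < largePos σ b' := by
      rw [hb, hb', Fin.lt_def]
      exact Nat.lt_succ_self _
    rw [← hb', ← hb, apply_largePos, apply_largePos]
    rcases (h.large_lt_large b b').1 hlt with hfb | ⟨-, hbb⟩
    · obtain ⟨d, -, hd⟩ := exists_isRecord_recordRank_eq_succ π.injective (hfb.trans_le (hf b'))
      have h₃ := (h.large_lt_small b d).2 (by omega)
      have h₄ := (h.small_lt_large d b').2 (by omega)
      rw [hb, Fin.lt_def] at h₃
      rw [hb', Fin.lt_def] at h₄
      simp only at h₄
      omega
    · rw [Fin.lt_def] at hbb ⊢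
      simpa using hbb
  · intro i j hi hj hij
    obtain ⟨c, rfl⟩ := exists_smallPos_eq hi.1
    obtain ⟨d, rfl⟩ := exists_smallPos_eq hj.1
    rw [apply_smallPos, apply_smallPos, Fin.lt_def]
    exact h.isRecord_of_isRunMax hj c ((h.small_lt_small c d).1 hij)

/-- Every small entry is bounded by a run-maximum weakly to its left. -/
theorem exists_isRunMax_le {N : ℕ} (σ : Equiv.Perm (Fin N)) (j : Fin N) (hj : IsSmall n σ j) :
    ∃ i ≤ j, IsRunMax n σ i ∧ σ j ≤ σ i := by
  induction j using WellFoundedLT.induction with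
  | ind j ih =>
    by_cases hmax : IsRunMax n σ j
    · exact ⟨j, le_rfl, hmax, le_rfl⟩
    · unfold IsRunMax at hmax
      push Not at hmax
      obtain ⟨j', hlt, hrun, hval⟩ := hmax hj
      obtain ⟨i, hi, himax, hle⟩ := ih j' hlt (hrun j' le_rfl hlt.le)
      exact ⟨i, hi.trans hlt.le, himax, hval.trans hle⟩

theorem IsPolyCauchyPerm.isRecord_of_isRunMax {σ : Equiv.Perm (Fin (n + k))}
    (h : IsPolyCauchyPerm n k σ) {c : Fin n} (hc : IsRunMax n σ (smallPos σ c)) :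
    IsRecord (smallPos σ) c := by
  intro d hd
  obtain ⟨i, hi, himax, hle⟩ := exists_isRunMax_le σ _ (isSmall_smallPos σ d)
  have := hle.trans_lt (h.2 i _ himax hc (hi.trans_lt hd))
  rwa [apply_smallPos, apply_smallPos, Fin.lt_def] at this

/-- The first small letter after a large one is a record. -/
theorem IsPolyCauchyPerm.exists_isRecord_between {σ : Equiv.Perm (Fin (n + k))}
    (h : IsPolyCauchyPerm n k σ) {b : Fin k} {c : Fin n} (hbc : largePos σ b < smallPos σ c) :
    ∃ e, IsRecord (smallPos σ) e ∧ largePos σ b < smallPos σ e ∧ smallPos σ e ≤ smallPos σ c := by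
  classical
  obtain ⟨e, he, hmin⟩ := exists_min_image
    ({d | largePos σ b < smallPos σ d} : Finset (Fin n)) (smallPos σ) ⟨c, by simpa using hbc⟩
  simp only [mem_filter, mem_univ, true_and] at he hmin
  refine ⟨e, h.isRecord_of_isRunMax ⟨isSmall_smallPos σ e, fun j hj hrun => ?_⟩, he, hmin c hbc⟩
  exfalso
  rcases le_or_gt j (largePos σ b) with hjb | hjb
  · exact not_isSmall_largePos σ b (hrun _ hjb he.le)
  · obtain ⟨d, rfl⟩ := exists_smallPos_eq (hrun j le_rfl hj.le)
    exact absurd hj (not_lt.2 (hmin d hjb))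

theorem IsPolyCauchyPerm.apply_le_of_large {σ : Equiv.Perm (Fin (n + k))}
    (h : IsPolyCauchyPerm n k σ) {i j : Fin (n + k)} (hij : i ≤ j)
    (hlarge : ∀ p, i ≤ p → p ≤ j → ¬ IsSmall n σ p) : σ i ≤ σ j := by
  obtain ⟨j, hj⟩ := j
  have hij' : (i : ℕ) ≤ j := hij
  clear hij
  induction j, hij' using Nat.le_induction with
  | base => exact le_rfl
  | succ j hle ih =>
    have hlt : (⟨j, by omega⟩ : Fin (n + k)) < ⟨j + 1, hj⟩ := Nat.lt_succ_self j
    refine (ih (by omega) fun p hp hp' => hlarge p hp (hp'.trans hlt.le)).trans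
      (h.1 ⟨j, by omega⟩ hj ?_ ?_).le
    · exact not_lt.1 (hlarge _ hle hlt.le)
    · exact not_lt.1 (hlarge _ (Fin.le_def.2 (Nat.le_succ_of_le hle)) le_rfl)

theorem IsPolyCauchyPerm.exists_isEncodedBy {σ : Equiv.Perm (Fin (n + k))}
    (h : IsPolyCauchyPerm n k σ) :
    ∃ (π : Equiv.Perm (Fin n)) (f : Fin k → ℕ),
      (∀ b, f b ≤ numRecords π) ∧ IsEncodedBy σ π f := by
  classical
  obtain ⟨π, hπ⟩ := exists_equiv_fin_lt_iff (Fintype.card_fin n) (smallPos_injective σ)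
  have hrec := isRecord_congr hπ
  have hle : ∀ c d, π c ≤ π d ↔ smallPos σ c ≤ smallPos σ d := fun c d => by
    rw [← not_lt, hπ, not_lt]
  let f : Fin k → ℕ := fun b => #{d | IsRecord (smallPos σ) d ∧ smallPos σ d < largePos σ b}
  have hf : ∀ {b b'}, largePos σ b ≤ largePos σ b' → f b ≤ f b' := fun hb =>
    card_le_card fun d hd => by
      simp only [mem_filter, mem_univ, true_and] at hd ⊢
      exact ⟨hd.1, hd.2.trans_le hb⟩
  have hsame : ∀ {b b'}, f b = f b' → b < b' → largePos σ b < largePos σ b' := by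
    intro b b' hfb hbb
    by_contra! hpos
    have hval := h.apply_le_of_large hpos fun p hp hp' hsmall => by
      obtain ⟨c, rfl⟩ := exists_smallPos_eq hsmall
      obtain ⟨e, he, hbe, hec⟩ := h.exists_isRecord_between
        (lt_of_le_of_ne hp (smallPos_ne_largePos σ c b').symm)
      refine (card_lt_card ((ssubset_iff_of_subset fun d hd => ?_).2 ⟨e, ?_, ?_⟩)).ne' hfb
      · simp only [mem_filter, mem_univ, true_and] at hd ⊢
        exact ⟨hd.1, hd.2.trans_le hpos⟩
      · simpa using ⟨he, hec.trans_lt (lt_of_le_of_ne hp' (smallPos_ne_largePos σ c b))⟩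
      · simpa using fun _ => hbe.le
    rw [apply_largePos, apply_largePos, Fin.le_def] at hval
    simp at hval
    omega
  refine ⟨π, f, fun b => card_le_card fun d hd => ?_,
    ⟨fun c d => (hπ c d).symm, fun b c => ⟨fun hbc => ?_, fun hbc => ?_⟩,
      fun b b' => ⟨fun hbb => ?_, ?_⟩⟩⟩
  · simp only [mem_filter, mem_univ, true_and, hrec] at hd ⊢
    exact hd.1
  · obtain ⟨e, he, hbe, hec⟩ := h.exists_isRecord_between hbc
    refine card_lt_card ((ssubset_iff_of_subset fun d hd => ?_).2 ⟨e, ?_, ?_⟩)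
    · simp only [mem_filter, mem_univ, true_and, hrec, hle] at hd ⊢
      exact ⟨hd.1, (hd.2.trans hbc).le⟩
    · simpa [hrec, hle] using ⟨he, hec⟩
    · simpa using fun _ => hbe.le
  · by_contra! hcb
    refine absurd hbc (not_lt.2 (card_le_card fun d hd => ?_))
    simp only [mem_filter, mem_univ, true_and, hrec, hle] at hd ⊢
    exact ⟨hd.1, hd.2.trans_lt (lt_of_le_of_ne hcb (smallPos_ne_largePos σ c b))⟩
  · rcases (hf hbb.le).lt_or_eq with hlt | heq
    · exact Or.inl hlt
    · refine Or.inr ⟨heq, ?_⟩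
      by_contra! hb
      rcases hb.lt_or_eq with hb | rfl
      · exact absurd (hsame heq.symm hb) (not_lt.2 hbb.le)
      · exact hbb.false
  · rintro (hlt | ⟨heq, hlt⟩)
    · by_contra! hb
      exact absurd hlt (not_lt.2 (hf hb))
    · exact hsame heq hlt

end Encoding

theorem card_polyCauchyPerm (n k : ℕ) :
    Nat.card {σ : Equiv.Perm (Fin (n + k)) // IsPolyCauchyPerm n k σ} = polyCauchy n k := by
  classical
  choose dec hdec using fun x : (_ : Equiv.Perm (Fin n)) × (Fin k → ℕ) =>
    exists_isEncodedBy x.1 x.2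
  rw [Nat.card_eq_fintype_card, Fintype.card_subtype]
  let codes : Finset ((_ : Equiv.Perm (Fin n)) × (Fin k → ℕ)) :=
    univ.sigma fun π => Fintype.piFinset fun _ => range (numRecords π + 1)
  have mem_codes : ∀ x, x ∈ codes ↔ ∀ b, x.2 b ≤ numRecords x.1 := fun x => by
    simp [codes]
  have hcard : #codes = polyCauchy n k := by
    simpa [codes, card_sigma, polyCauchy] using sum_numRecords n fun m => (m + 1) ^ k
  rw [← hcard]
  symm
  refine card_nbij dec (fun x hx => ?_) (fun x hx y hy hxy => ?_) (fun σ hσ => ?_)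
  · simpa using (hdec x).isPolyCauchyPerm ((mem_codes x).1 hx)
  · obtain ⟨h₁, h₂⟩ := (hdec x).code_unique (hxy ▸ hdec y) ((mem_codes x).1 hx)
      ((mem_codes y).1 hy)
    exact Sigma.ext h₁ (heq_of_eq h₂)
  · obtain ⟨π, f, hf, henc⟩ := IsPolyCauchyPerm.exists_isEncodedBy (by simpa using hσ)
    exact ⟨⟨π, f⟩, (mem_codes _).2 hf, (hdec ⟨π, f⟩).perm_unique henc⟩
end

section
/- For all integers n ≥ 1 and k ≥ 0, the following identity holds in the rational numbers: ĉ_{n,k} = Σ_{ℓ=1}^{n} Σ_{m=1}^{n} (1/m!) · c(n,m) · c(m,ℓ) · B_{ℓ,k}. -/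
/-- Poly-Bernoulli numbers with negative upper index:
`B_{n,k} = Σ_{m=0}^n (−1)^{n+m}·m!·S(n,m)·(m+1)^k`. -/
def polyBernoulli (n k : ℕ) : ℤ :=
  ∑ m ∈ Finset.range (n + 1),
    (-1) ^ (n + m) * (Nat.factorial m : ℤ) * stirling2 n m * (m + 1) ^ k

theorem stirling2_eq_zero_of_lt : ∀ {n m : ℕ}, n < m → stirling2 n m = 0
  | 0, _ + 1, _ => by simp [stirling2]
  | n + 1, m + 1, h => by
    simp [stirling2, stirling2_eq_zero_of_lt (show n < m by omega),
      stirling2_eq_zero_of_lt (show n < m + 1 by omega)]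

/-- Orthogonality of the Stirling numbers of the first and second kind. -/
theorem sum_stirling1_mul_stirling2 (m j N : ℕ) (h : m < N) :
    ∑ l ∈ Finset.range N, (stirling1 m l : ℤ) * ((-1) ^ (l + j) * stirling2 l j) =
      if m = j then 1 else 0 := by
  induction m generalizing j N with
  | zero =>
    obtain ⟨N, rfl⟩ : ∃ M, N = M + 1 := ⟨N - 1, by omega⟩
    rw [Finset.sum_range_succ']
    cases j <;> simp [stirling1, stirling2]
  | succ m ih =>
    obtain ⟨N, rfl⟩ : ∃ M, N = M + 1 := ⟨N - 1, by omega⟩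
    rw [Finset.sum_range_succ']
    cases j with
    | zero => simp [stirling1, stirling2]
    | succ j =>
      have h₁ := ih (j + 1) (N + 1) (by omega)
      rw [Finset.sum_range_succ'] at h₁
      have h₂ := ih (j + 1) N (by omega)
      have h₃ := ih j N (by omega)
      have key : ∑ l ∈ Finset.range N, (stirling1 (m + 1) (l + 1) : ℤ) *
            ((-1) ^ (l + 1 + (j + 1)) * stirling2 (l + 1) (j + 1)) =
          m * ∑ l ∈ Finset.range N, (stirling1 m (l + 1) : ℤ) *
            ((-1) ^ (l + 1 + (j + 1)) * stirling2 (l + 1) (j + 1)) -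
          (j + 1) * ∑ l ∈ Finset.range N, (stirling1 m l : ℤ) *
            ((-1) ^ (l + (j + 1)) * stirling2 l (j + 1)) +
          ∑ l ∈ Finset.range N, (stirling1 m l : ℤ) * ((-1) ^ (l + j) * stirling2 l j) := by
        rw [Finset.mul_sum, Finset.mul_sum, ← Finset.sum_sub_distrib, ← Finset.sum_add_distrib]
        refine Finset.sum_congr rfl fun l _ => ?_
        simp only [stirling1, stirling2]
        push_cast
        ring
      simp only [stirling2, Nat.cast_zero, mul_zero, add_zero] at h₁ key ⊢
      rw [key, h₁, h₂, h₃]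
      by_cases hj : m = j + 1
      · subst hj
        simp
      · simp [hj]

theorem polyBernoulli_eq_sum_range {l n : ℕ} (h : l ≤ n) (k : ℕ) :
    polyBernoulli l k = ∑ j ∈ Finset.range (n + 1),
      (-1) ^ (l + j) * (Nat.factorial j : ℤ) * stirling2 l j * (j + 1) ^ k := by
  refine Finset.sum_subset (Finset.range_mono (by omega)) fun j _ hj => ?_
  rw [stirling2_eq_zero_of_lt (by simpa using hj)]
  simp

/-- Stirling inversion of the definition of the poly-Bernoulli numbers. -/
theorem sum_stirling1_mul_polyBernoulli {m n : ℕ} (h : m ≤ n) (k : ℕ) :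
    ∑ l ∈ Finset.range (n + 1), (stirling1 m l : ℤ) * polyBernoulli l k =
      (Nat.factorial m : ℤ) * (m + 1) ^ k := by
  calc
    _ = ∑ l ∈ Finset.range (n + 1), ∑ j ∈ Finset.range (n + 1),
        ((Nat.factorial j : ℤ) * (j + 1) ^ k) *
          ((stirling1 m l : ℤ) * ((-1) ^ (l + j) * stirling2 l j)) := by
      refine Finset.sum_congr rfl fun l hl => ?_
      rw [polyBernoulli_eq_sum_range (Finset.mem_range_succ_iff.mp hl), Finset.mul_sum]
      exact Finset.sum_congr rfl fun j _ => by ring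
    _ = _ := by
      rw [Finset.sum_comm]
      simp_rw [← Finset.mul_sum, sum_stirling1_mul_stirling2 m _ (n + 1) (by omega)]
      simp [h]

theorem sum_range_succ_eq_sum_Icc_one {M : Type*} [AddCommMonoid M] (f : ℕ → M) (n : ℕ)
    (h : f 0 = 0) : ∑ i ∈ Finset.range (n + 1), f i = ∑ i ∈ Finset.Icc 1 n, f i := by
  refine (Finset.sum_subset (fun i hi => ?_) fun i hi hi' => ?_).symm
  · simp at hi ⊢
    omega
  · obtain rfl : i = 0 := by
      simp at hi hi'
      omega
    exact h

theorem polyCauchy_eq_sum_polyBernoulli (n k : ℕ) (hn : 1 ≤ n) :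
    (polyCauchy n k : ℚ) = ∑ ℓ ∈ Finset.Icc 1 n, ∑ m ∈ Finset.Icc 1 n,
      (1 / (Nat.factorial m : ℚ)) * stirling1 n m * stirling1 m ℓ * polyBernoulli ℓ k := by
  have stirling1_zero : ∀ {m : ℕ}, 1 ≤ m → stirling1 m 0 = 0
    | _ + 1, _ => by simp [stirling1]
  rw [Finset.sum_comm, polyCauchy,
    sum_range_succ_eq_sum_Icc_one _ _ (by simp [stirling1_zero hn]), Nat.cast_sum]
  refine Finset.sum_congr rfl fun m hm => ?_
  obtain ⟨hm₁, hm₂⟩ := Finset.mem_Icc.mp hm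
  have key := sum_stirling1_mul_polyBernoulli hm₂ k
  rw [sum_range_succ_eq_sum_Icc_one _ _ (by simp [stirling1_zero hm₁])] at key
  have keyQ : ∑ l ∈ Finset.Icc 1 n, (stirling1 m l : ℚ) * polyBernoulli l k =
      (Nat.factorial m : ℚ) * (m + 1) ^ k := by
    exact_mod_cast key
  simp_rw [mul_assoc]
  rw [← Finset.mul_sum, ← Finset.mul_sum, keyQ]
  have := Nat.cast_ne_zero (R := ℚ).mpr (Nat.factorial_ne_zero m)
  push_cast
  field_simp
end
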